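/- Let k be a field of characteristic 0, n ≥ 2, A = M_n(k), and let E = Σ_{i=1}^{n−1} i·E_{i,i+1}, F_0 = Σ_{i=1}^{n−1} (n−i)·E_{i+1,i}, H = Σ_{i=1}^{n} (n+1−2i)·E_{ii} (the images of the standard sl₂-triple under the irreducible n-dimensional representation of sl₂(k)), and let g = span{E,H,F_0}, a Lie subalgebra of A. Let F be a unital associative k-algebra. Then an invertible diagonal matrix D = diag(f₁,…,f_n) ∈ GL_n(F) (with each f_i ∈ F invertible) satisfies D·(g,A)(F)·D^{−1} = (g,A)(F) if and only if Δ^(m)(f₁f₂^{−1}, f₂f₃^{−1}, …, f_{m+1}f_{m+2}^{−1}) ∈ I_m(F) for m = 1, 2, …, n−2, where Δ^(m)(m₁,…,m_{m+1}) = Σ_{r=0}^{m} (−1)^r·binom(m,r)·m_{r+1}. -/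

import Mathlib

open Submodule TensorProduct

variable (K : Type*) [Field K]

/-- The span of all products `a * b`, `a ∈ S`, `b ∈ T` (the subspace `S·T`). -/
def pSpan {R : Type*} [NonUnitalRing R] [Module K R] (S T : Submodule K R) : Submodule K R :=
  Submodule.span K {x | ∃ a ∈ S, ∃ b ∈ T, x = a * b}

/-- The span of all commutators `a * b - b * a`, `a ∈ S`, `b ∈ T` (the subspace `[S, T]`). -/
def bSpan {R : Type*} [NonUnitalRing R] [Module K R] (S T : Submodule K R) : Submodule K R :=
  Submodule.span K {x | ∃ a ∈ S, ∃ b ∈ T, x = a * b - b * a}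

/-- The `k`-th commutator space `S^(k)`: `S^(0) = S`, `S^(k) = [S, S^(k-1)]`.
For `S = ⊤` this is the commutator space `F^(k)` of the algebra. -/
def cSp {R : Type*} [NonUnitalRing R] [Module K R] (S : Submodule K R) : ℕ → Submodule K R
  | 0 => S
  | (k+1) => bSpan K S (cSp S k)

/-- `IklS K S ℓ k` is `I_k^ℓ(R, S)`: the sum of `S^(λ₁) ⋯ S^(λ_ℓ)` over
`λ₁ + ⋯ + λ_ℓ = k`, defined via the recursion `I_k^1 = S^(k)`,
`I_k^ℓ = Σ_{0 ≤ i ≤ k} S^(i) · I_{k-i}^{ℓ-1}`.  The first argument is the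
superscript `ℓ`, the second the subscript `k`; the (unused) value at `ℓ = 0` is `⊥`.
For `S = ⊤` this is `I_k^ℓ(F)`. -/
def IklS {R : Type*} [NonUnitalRing R] [Module K R] (S : Submodule K R) :
    ℕ → ℕ → Submodule K R
  | 0, _ => ⊥
  | 1, k => cSp K S k
  | (ℓ+2), k => ∑ i ∈ Finset.range (k+1), pSpan K (cSp K S i) (IklS S (ℓ+1) (k-i))

/-- `I_k^{≤ℓ}(F) = Σ_{1 ≤ ℓ' ≤ ℓ} I_k^{ℓ'}(F)`. -/
def Ikle {R : Type*} [NonUnitalRing R] [Module K R] (ℓ k : ℕ) : Submodule K R :=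
  ∑ ℓ' ∈ Finset.Icc 1 ℓ, IklS K (⊤ : Submodule K R) ℓ' k

/-- `I_k(F) = Σ_{ℓ ≥ 1} I_k^ℓ(F)`. -/
def Ik (R : Type*) [NonUnitalRing R] [Module K R] (k : ℕ) : Submodule K R :=
  ⨆ ℓ : ℕ, IklS K (⊤ : Submodule K R) (ℓ + 1) k

/-- `g^n`: the span of all products of `n` elements of `g` (set to `⊥` for `n = 0`). -/
def gPow {R : Type*} [NonUnitalRing R] [Module K R] (g : Submodule K R) : ℕ → Submodule K R
  | 0 => ⊥
  | 1 => g
  | (n+2) => pSpan K g (gPow g (n+1))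

/-- The Lie subalgebra (under the commutator bracket) generated by a subspace `S`:
the smallest subspace containing `S` and closed under `(x, y) ↦ x * y - y * x`. -/
def lieGen {R : Type*} [NonUnitalRing R] [Module K R] (S : Submodule K R) : Submodule K R :=
  sInf {T | S ≤ T ∧ ∀ x ∈ T, ∀ y ∈ T, x * y - y * x ∈ T}

/-- The subspace `S ⊗ T` of `F ⊗[K] A`: the span of all pure tensors `f ⊗ a`
with `f ∈ S`, `a ∈ T`. -/
def tSpan {F A : Type*} [AddCommGroup F] [Module K F] [AddCommGroup A] [Module K A]
    (S : Submodule K F) (T : Submodule K A) : Submodule K (F ⊗[K] A) :=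
  Submodule.span K {z | ∃ f ∈ S, ∃ a ∈ T, z = f ⊗ₜ[K] a}

/-- The current Lie algebra `(g, A)(F)`: the Lie subalgebra of `F ⊗ A` (with the
commutator bracket) generated by `F ⊗ g`. -/
def currentLie {F A : Type*} [NonUnitalRing F] [Module K F] [SMulCommClass K F F]
    [IsScalarTower K F F] [Ring A] [Algebra K A] (g : Submodule K A) :
    Submodule K (F ⊗[K] A) :=
  lieGen K (tSpan K (⊤ : Submodule K F) g)

/-- The current Lie algebra `(g, M_n(k))(F)` realized inside `M_n(F)`. -/
def matCurrent (K : Type*) [Field K] {n : ℕ} (Fa : Type*) [Ring Fa] [Algebra K Fa]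
    (g : Submodule K (Matrix (Fin n) (Fin n) K)) :
    Submodule K (Matrix (Fin n) (Fin n) Fa) :=
  lieGen K (Submodule.span K
    {X : Matrix (Fin n) (Fin n) Fa | ∃ u : Fa, ∃ M ∈ g, X = u • M.map (algebraMap K Fa)})

/-- `E = Σ_{i=1}^{n−1} i·E_{i,i+1}` in `M_n(k)`, `n = m+1`. -/
def eMat (K : Type*) [Field K] (m : ℕ) : Matrix (Fin (m + 1)) (Fin (m + 1)) K :=
  ∑ i : Fin m, Matrix.single i.castSucc i.succ (((i : ℕ) + 1 : ℕ) : K)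

/-- `F₀ = Σ_{i=1}^{n−1} (n−i)·E_{i+1,i}` in `M_n(k)`, `n = m+1`. -/
def fMat (K : Type*) [Field K] (m : ℕ) : Matrix (Fin (m + 1)) (Fin (m + 1)) K :=
  ∑ i : Fin m, Matrix.single i.succ i.castSucc ((m - (i : ℕ) : ℕ) : K)

/-- `H = Σ_{i=1}^{n} (n+1−2i)·E_{ii}` in `M_n(k)`, `n = m+1`. -/
def hMat (K : Type*) [Field K] (m : ℕ) : Matrix (Fin (m + 1)) (Fin (m + 1)) K :=
  ∑ j : Fin (m + 1), Matrix.single j j ((m : K) - 2 * ((j : ℕ) : K))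

section CommutatorSpaces

variable {K} {R : Type*} [Ring R] [Algebra K R]

theorem bracket_mem_bSpan {S T : Submodule K R} {a b : R} (ha : a ∈ S) (hb : b ∈ T) :
    a * b - b * a ∈ bSpan K S T :=
  Submodule.subset_span ⟨a, ha, b, hb, rfl⟩

theorem bSpan_le {S T U : Submodule K R} (h : ∀ a ∈ S, ∀ b ∈ T, a * b - b * a ∈ U) :
    bSpan K S T ≤ U :=
  Submodule.span_le.2 (by rintro _ ⟨a, ha, b, hb, rfl⟩; exact h a ha b hb)

theorem pSpan_le {S T U : Submodule K R} (h : ∀ a ∈ S, ∀ b ∈ T, a * b ∈ U) :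
    pSpan K S T ≤ U :=
  Submodule.span_le.2 (by rintro _ ⟨a, ha, b, hb, rfl⟩; exact h a ha b hb)

theorem cSp_succ_le (k : ℕ) :
    cSp K (⊤ : Submodule K R) (k + 1) ≤ cSp K ⊤ k := by
  induction k with
  | zero => exact le_top
  | succ k ih => exact bSpan_le fun a ha b hb => bracket_mem_bSpan ha (ih hb)

theorem bracket_mem_cSp_succ (a : R) {b : R} {k : ℕ} (hb : b ∈ cSp K (⊤ : Submodule K R) k) :
    a * b - b * a ∈ cSp K (⊤ : Submodule K R) (k + 1) :=
  bracket_mem_bSpan (by exact Submodule.mem_top) hb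

theorem bracket_mem_cSp {i j : ℕ} {a b : R} (ha : a ∈ cSp K (⊤ : Submodule K R) i)
    (hb : b ∈ cSp K (⊤ : Submodule K R) j) :
    a * b - b * a ∈ cSp K (⊤ : Submodule K R) (i + j + 1) := by
  induction i generalizing a b j with
  | zero => simpa using bracket_mem_cSp_succ a hb
  | succ i ih =>
    refine Submodule.span_induction (p := fun a _ => a * b - b * a ∈ cSp K ⊤ (i + 1 + j + 1))
      ?_ ?_ ?_ ?_ ha
    · rintro _ ⟨x, -, y, hy, rfl⟩
      have e : (x * y - y * x) * b - b * (x * y - y * x) =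
          (x * (y * b - b * y) - (y * b - b * y) * x) -
          (y * (x * b - b * x) - (x * b - b * x) * y) := by noncomm_ring
      rw [e]
      refine sub_mem ?_ ?_
      · have := bracket_mem_cSp_succ x (ih hy hb)
        rwa [show i + 1 + j + 1 = i + j + 1 + 1 by omega]
      · have := ih hy (bracket_mem_cSp_succ x hb)
        rwa [show i + 1 + j + 1 = i + (j + 1) + 1 by omega]
    · simp
    · intro x y _ _ hx hy
      convert add_mem hx hy using 1
      noncomm_ring
    · intro c x _ hx
      convert Submodule.smul_mem _ c hx using 1
      simp [smul_sub]

theorem mul_mem_IklS {ℓ i j k : ℕ} (h : i + j = k) {u v : R}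
    (hu : u ∈ cSp K (⊤ : Submodule K R) i) (hv : v ∈ IklS K (⊤ : Submodule K R) (ℓ + 1) j) :
    u * v ∈ IklS K (⊤ : Submodule K R) (ℓ + 2) k := by
  subst h
  have h1 : pSpan K (cSp K ⊤ i) (IklS K ⊤ (ℓ + 1) (i + j - i)) ≤
      IklS K (⊤ : Submodule K R) (ℓ + 2) (i + j) :=
    Finset.single_le_sum (f := fun i' => pSpan K (cSp K (⊤ : Submodule K R) i')
      (IklS K ⊤ (ℓ + 1) (i + j - i'))) (fun _ _ => bot_le) (Finset.mem_range.2 (by omega))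
  refine h1 (Submodule.subset_span ⟨u, hu, v, ?_, rfl⟩)
  rwa [Nat.add_sub_cancel_left]

theorem IklS_succ_succ_le {ℓ k : ℕ} {U : Submodule K R}
    (h : ∀ i j, i + j = k → ∀ u ∈ cSp K (⊤ : Submodule K R) i,
      ∀ v ∈ IklS K (⊤ : Submodule K R) (ℓ + 1) j, u * v ∈ U) :
    IklS K (⊤ : Submodule K R) (ℓ + 2) k ≤ U := by
  refine Finset.sum_induction (fun i => pSpan K (cSp K (⊤ : Submodule K R) i)
    (IklS K ⊤ (ℓ + 1) (k - i))) (· ≤ U) (fun _ _ => sup_le) bot_le ?_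
  intro i hi
  have := Finset.mem_range.1 hi
  exact pSpan_le (h i (k - i) (by omega))

theorem IklS_succ_le (ℓ k : ℕ) :
    IklS K (⊤ : Submodule K R) (ℓ + 1) (k + 1) ≤ IklS K ⊤ (ℓ + 1) k := by
  induction ℓ generalizing k with
  | zero => exact cSp_succ_le k
  | succ ℓ ih =>
    refine IklS_succ_succ_le fun i j hij u hu v hv => ?_
    cases i with
    | zero =>
      obtain rfl : j = k + 1 := by omega
      exact mul_mem_IklS (by omega) hu (ih k hv)
    | succ i => exact mul_mem_IklS (by omega) (cSp_succ_le i hu) hv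

theorem bracket_mem_IklS {ℓ i j : ℕ} {u v : R} (hu : u ∈ cSp K (⊤ : Submodule K R) i)
    (hv : v ∈ IklS K (⊤ : Submodule K R) (ℓ + 1) j) :
    u * v - v * u ∈ IklS K (⊤ : Submodule K R) (ℓ + 1) (i + j + 1) := by
  induction ℓ generalizing j v with
  | zero => exact bracket_mem_cSp hu hv
  | succ ℓ ih =>
    have key : IklS K (⊤ : Submodule K R) (ℓ + 2) j ≤
        (IklS K (⊤ : Submodule K R) (ℓ + 2) (i + j + 1)).comap
          (LinearMap.mulLeft K u - LinearMap.mulRight K u) := by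
      refine IklS_succ_succ_le fun a b hab x hx y hy => ?_
      have e : u * (x * y) - x * y * u = (u * x - x * u) * y + x * (u * y - y * u) := by
        noncomm_ring
      simp only [Submodule.mem_comap, LinearMap.sub_apply, LinearMap.mulLeft_apply,
        LinearMap.mulRight_apply]
      rw [e]
      exact add_mem (mul_mem_IklS (by omega) (bracket_mem_cSp hu hx) hy)
        (mul_mem_IklS (by omega) hx (ih hy))
    simpa using key hv

theorem IklS_le_Ik (ℓ k : ℕ) : IklS K (⊤ : Submodule K R) (ℓ + 1) k ≤ Ik K R k :=
  le_iSup (fun ℓ => IklS K (⊤ : Submodule K R) (ℓ + 1) k) ℓ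

theorem Ik_le {k : ℕ} {U : Submodule K R}
    (h : ∀ ℓ, IklS K (⊤ : Submodule K R) (ℓ + 1) k ≤ U) : Ik K R k ≤ U :=
  iSup_le h

theorem mem_Ik_zero (x : R) : x ∈ Ik K R 0 :=
  IklS_le_Ik 0 0 (Submodule.mem_top : x ∈ (⊤ : Submodule K R))

theorem Ik_antitone : Antitone (Ik K R) :=
  antitone_nat_of_succ_le fun k => Ik_le fun ℓ => (IklS_succ_le ℓ k).trans (IklS_le_Ik ℓ k)

theorem cSp_mul_mem_Ik {i j : ℕ} {u v : R} (hu : u ∈ cSp K (⊤ : Submodule K R) i)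
    (hv : v ∈ Ik K R j) : u * v ∈ Ik K R (i + j) := by
  have key : Ik K R j ≤ (Ik K R (i + j)).comap (LinearMap.mulLeft K u) :=
    Ik_le fun ℓ w hw => IklS_le_Ik (ℓ + 1) _ (mul_mem_IklS rfl hu hw)
  exact key hv

theorem cSp_bracket_mem_Ik {i j : ℕ} {u v : R} (hu : u ∈ cSp K (⊤ : Submodule K R) i)
    (hv : v ∈ Ik K R j) : u * v - v * u ∈ Ik K R (i + j + 1) := by
  have key : Ik K R j ≤
      (Ik K R (i + j + 1)).comap (LinearMap.mulLeft K u - LinearMap.mulRight K u) :=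
    Ik_le fun ℓ w hw => IklS_le_Ik ℓ _ (bracket_mem_IklS hu hw)
  simpa using key hv

theorem mul_mem_Ik {i j : ℕ} {u v : R} (hu : u ∈ Ik K R i) (hv : v ∈ Ik K R j) :
    u * v ∈ Ik K R (i + j) := by
  have key : ∀ ℓ i, IklS K (⊤ : Submodule K R) (ℓ + 1) i ≤
      (Ik K R (i + j)).comap (LinearMap.mulRight K v) := by
    intro ℓ
    induction ℓ with
    | zero => exact fun i u hu => cSp_mul_mem_Ik hu hv
    | succ ℓ ih =>
      intro i
      refine IklS_succ_succ_le fun a b hab x hx y hy => ?_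
      have := cSp_mul_mem_Ik hx (ih b hy)
      simpa [mul_assoc, ← hab, add_assoc] using this
  exact Ik_le (fun ℓ => key ℓ i) hu

theorem bracket_mem_Ik {i j : ℕ} {u v : R} (hu : u ∈ Ik K R i) (hv : v ∈ Ik K R j) :
    u * v - v * u ∈ Ik K R (i + j + 1) := by
  have key : ∀ ℓ i, IklS K (⊤ : Submodule K R) (ℓ + 1) i ≤
      (Ik K R (i + j + 1)).comap (LinearMap.mulRight K v - LinearMap.mulLeft K v) := by
    intro ℓ
    induction ℓ with
    | zero => exact fun i u hu => cSp_bracket_mem_Ik hu hv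
    | succ ℓ ih =>
      intro i
      refine IklS_succ_succ_le fun a b hab x hx y hy => ?_
      have h1 := cSp_mul_mem_Ik hx (ih b hy)
      have h2 := mul_mem_Ik (cSp_bracket_mem_Ik hx hv) (IklS_le_Ik ℓ b hy)
      have e : x * y * v - v * (x * y) = x * (y * v - v * y) + (x * v - v * x) * y := by
        noncomm_ring
      simp only [Submodule.mem_comap, LinearMap.sub_apply, LinearMap.mulLeft_apply,
        LinearMap.mulRight_apply] at h1 ⊢
      rw [e]
      refine add_mem ?_ ?_
      · rwa [show i + j + 1 = a + (b + j + 1) by omega]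
      · rwa [show i + j + 1 = a + j + 1 + b by omega]
  simpa using Ik_le (fun ℓ => key ℓ i) hu

theorem mul_mem_Ik_left (x : R) {k : ℕ} {u : R} (hu : u ∈ Ik K R k) : x * u ∈ Ik K R k := by
  simpa using mul_mem_Ik (mem_Ik_zero x) hu

theorem mul_mem_Ik_right {k : ℕ} {u : R} (hu : u ∈ Ik K R k) (x : R) : u * x ∈ Ik K R k := by
  simpa using mul_mem_Ik hu (mem_Ik_zero x)

end CommutatorSpaces

section SmoothSequences

variable {R : Type*} [Ring R] [Algebra K R]

/-- `SmoothSeq K N k u`: the `m`-th differences of the first `N` terms of `u` lie in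
`I_{m+k}(R)` for all `m`. -/
def SmoothSeq : ℕ → ℕ → (ℕ → R) → Prop
  | 0, _, _ => True
  | N + 1, k, u => (∀ i ≤ N, u i ∈ Ik K R k) ∧ SmoothSeq N (k + 1) (fun i => u (i + 1) - u i)

variable {K}

namespace SmoothSeq

theorem congr {N k : ℕ} {u v : ℕ → R} (h : SmoothSeq K N k u) (e : ∀ i < N, u i = v i) :
    SmoothSeq K N k v := by
  induction N generalizing k u v with
  | zero => trivial
  | succ N ih =>
    refine ⟨fun i hi => e i (by omega) ▸ h.1 i hi, ih h.2 fun i hi => ?_⟩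
    rw [e i (by omega), e (i + 1) (by omega)]

theorem zero (N k : ℕ) : SmoothSeq K N k (fun _ => (0 : R)) := by
  induction N generalizing k with
  | zero => trivial
  | succ N ih => exact ⟨fun _ _ => zero_mem _, by simpa using ih (k + 1)⟩

theorem const (N : ℕ) {k : ℕ} {x : R} (hx : x ∈ Ik K R k) : SmoothSeq K N k (fun _ => x) := by
  cases N with
  | zero => trivial
  | succ N => exact ⟨fun _ _ => hx, by simpa using zero N (k + 1)⟩

theorem add {N k : ℕ} {u v : ℕ → R} (hu : SmoothSeq K N k u) (hv : SmoothSeq K N k v) :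
    SmoothSeq K N k (fun i => u i + v i) := by
  induction N generalizing k u v with
  | zero => trivial
  | succ N ih =>
    refine ⟨fun i hi => add_mem (hu.1 i hi) (hv.1 i hi), (ih hu.2 hv.2).congr fun i _ => ?_⟩
    noncomm_ring

theorem neg {N k : ℕ} {u : ℕ → R} (hu : SmoothSeq K N k u) :
    SmoothSeq K N k (fun i => -u i) := by
  induction N generalizing k u with
  | zero => trivial
  | succ N ih =>
    refine ⟨fun i hi => neg_mem (hu.1 i hi), (ih hu.2).congr fun i _ => ?_⟩
    noncomm_ring

theorem anti {N k l : ℕ} {u : ℕ → R} (hu : SmoothSeq K N l u) (h : k ≤ l) :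
    SmoothSeq K N k u := by
  induction N generalizing k l u with
  | zero => trivial
  | succ N ih =>
    exact ⟨fun i hi => Ik_antitone h (hu.1 i hi), ih hu.2 (by omega)⟩

theorem of_succ {N k : ℕ} {u : ℕ → R} (hu : SmoothSeq K (N + 1) k u) : SmoothSeq K N k u := by
  induction N generalizing k u with
  | zero => trivial
  | succ N ih => exact ⟨fun i hi => hu.1 i (by omega), ih hu.2⟩

theorem shift {N k : ℕ} {u : ℕ → R} (hu : SmoothSeq K (N + 1) k u) :
    SmoothSeq K N k (fun i => u (i + 1)) :=
  (hu.of_succ.add (hu.2.anti (Nat.le_succ k))).congr fun i _ => by abel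

theorem mul {N k l : ℕ} {u v : ℕ → R} (hu : SmoothSeq K N k u) (hv : SmoothSeq K N l v) :
    SmoothSeq K N (k + l) (fun i => u i * v i) := by
  induction N generalizing k l u v with
  | zero => trivial
  | succ N ih =>
    refine ⟨fun i hi => mul_mem_Ik (hu.1 i hi) (hv.1 i hi), ?_⟩
    refine (((ih hu.2 hv.of_succ).anti (k := k + l + 1) (by omega)).add
      ((ih hu.shift hv.2).anti (by omega))).congr fun i _ => ?_
    noncomm_ring

theorem mul_zero {N k : ℕ} {u v : ℕ → R} (hu : SmoothSeq K N k u) (hv : SmoothSeq K N 0 v) :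
    SmoothSeq K N k (fun i => u i * v i) := by
  simpa using hu.mul hv

theorem zero_mul {N k : ℕ} {u v : ℕ → R} (hu : SmoothSeq K N 0 u) (hv : SmoothSeq K N k v) :
    SmoothSeq K N k (fun i => u i * v i) := by
  simpa using hu.mul hv

theorem bracket {N k l : ℕ} {u v : ℕ → R} (hu : SmoothSeq K N k u) (hv : SmoothSeq K N l v) :
    SmoothSeq K N (k + l + 1) (fun i => u i * v i - v i * u i) := by
  induction N generalizing k l u v with
  | zero => trivial
  | succ N ih =>
    refine ⟨fun i hi => bracket_mem_Ik (hu.1 i hi) (hv.1 i hi), ?_⟩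
    refine (((ih hu.2 hv.of_succ).anti (k := k + l + 1 + 1) (by omega)).add
      ((ih hu.shift hv.2).anti (by omega))).congr fun i _ => ?_
    noncomm_ring

theorem inv {N : ℕ} {u : ℕ → Rˣ} (hu : SmoothSeq K N 0 (fun i => (u i : R))) :
    SmoothSeq K N 0 (fun i => ((u i)⁻¹ : Rˣ).1) := by
  induction N generalizing u with
  | zero => trivial
  | succ N ih =>
    refine ⟨fun i _ => mem_Ik_zero _, ?_⟩
    have h1 : SmoothSeq K N 0 (fun i => ((u (i + 1))⁻¹ : Rˣ).1) := ih hu.shift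
    exact ((h1.zero_mul (hu.2.mul_zero (ih hu.of_succ))).neg).congr fun i _ => by
      simp [mul_sub, sub_mul]

theorem mem_Ik {N k : ℕ} {u : ℕ → R} (hu : SmoothSeq K N k u) {i : ℕ} (hi : i < N) :
    u i ∈ Ik K R k := by
  cases N with
  | zero => omega
  | succ N => exact hu.1 i (by omega)

theorem conj_inv {N k : ℕ} {f : ℕ → Rˣ}
    (hf : SmoothSeq K N 0 (fun i => (f i : R) * ((f (i + 1))⁻¹ : Rˣ).1))
    {u : ℕ → R} (hu : SmoothSeq K N k u) :
    SmoothSeq K N k (fun i => ((f i)⁻¹ : Rˣ).1 * u i * f i) := by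
  induction N generalizing k u with
  | zero => trivial
  | succ N ih =>
    refine ⟨fun i hi => mul_mem_Ik_right (mul_mem_Ik_left _ (hu.1 i hi)) _, ?_⟩
    have hg := hf.of_succ
    have hg' : SmoothSeq K N 0 (fun i => (f (i + 1) : R) * ((f i)⁻¹ : Rˣ).1) := by
      refine (inv (u := fun i => f i * (f (i + 1))⁻¹) (hg.congr fun i _ => ?_)).congr
        fun i _ => ?_
      · simp
      · simp
    have hT := hu.2.add ((hg.bracket hu.shift).anti (k := k + 1) (by omega) |>.mul_zero hg')
    exact (ih hg hT).congr fun i _ => by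
      simp [mul_sub, sub_mul, mul_assoc]

theorem inv_mul_succ {N : ℕ} {f : ℕ → Rˣ}
    (hf : SmoothSeq K N 0 (fun i => (f i : R) * ((f (i + 1))⁻¹ : Rˣ).1)) :
    SmoothSeq K N 0 (fun i => ((f i)⁻¹ : Rˣ).1 * f (i + 1)) := by
  refine (hf.conj_inv (inv (u := fun i => f i * (f (i + 1))⁻¹)
    (hf.congr fun i _ => by simp))).congr fun i _ => ?_
  simp [mul_assoc]

theorem inv_mul_mul_succ {N : ℕ} {f : ℕ → Rˣ}
    (hf : SmoothSeq K N 0 (fun i => (f i : R) * ((f (i + 1))⁻¹ : Rˣ).1)) (x : R) :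
    SmoothSeq K N 0 (fun i => ((f i)⁻¹ : Rˣ).1 * x * f (i + 1)) :=
  ((hf.conj_inv (const N (mem_Ik_zero x))).zero_mul hf.inv_mul_succ).congr fun i _ => by
    simp [mul_assoc]

theorem mul_mul_inv_succ {N : ℕ} {f : ℕ → Rˣ}
    (hf : SmoothSeq K N 0 (fun i => (f i : R) * ((f (i + 1))⁻¹ : Rˣ).1)) (x : R) :
    SmoothSeq K N 0 (fun i => (f i : R) * x * ((f (i + 1))⁻¹ : Rˣ).1) := by
  simpa using inv_mul_mul_succ (f := fun i => (f i)⁻¹) (by simpa using hf.inv_mul_succ) x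

theorem reverse {N k : ℕ} {u : ℕ → R} (hu : SmoothSeq K N k u) :
    SmoothSeq K N k (fun i => u (N - 1 - i)) := by
  induction N generalizing k u with
  | zero => trivial
  | succ N ih =>
    refine ⟨fun i hi => hu.1 _ (by omega), (ih hu.2).neg.congr fun i hi => ?_⟩
    beta_reduce
    rw [show N + 1 - 1 - i = N - 1 - i + 1 by omega,
      show N + 1 - 1 - (i + 1) = N - 1 - i by omega]
    abel

theorem reverse_units {N : ℕ} {f : ℕ → Rˣ}
    (hf : SmoothSeq K N 0 (fun i => (f i : R) * ((f (i + 1))⁻¹ : Rˣ).1)) :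
    SmoothSeq K N 0 (fun i => (f (N - i) : R) * ((f (N - (i + 1)))⁻¹ : Rˣ).1) := by
  refine (inv (u := fun i => f i * (f (i + 1))⁻¹)
    (hf.congr fun i _ => by simp)).reverse.congr fun i hi => ?_
  rw [show N - i = N - 1 - i + 1 by omega, show N - (i + 1) = N - 1 - i by omega]
  simp

theorem iff_fwdDiff {N k : ℕ} {u : ℕ → R} :
    SmoothSeq K N k u ↔ ∀ m < N, (fwdDiff 1)^[m] u 0 ∈ Ik K R (m + k) := by
  induction N generalizing k u with
  | zero => simp [SmoothSeq]
  | succ N ih =>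
    constructor
    · rintro ⟨h0, h⟩ m hm
      cases m with
      | zero => simpa using h0 0 (by omega)
      | succ m =>
        have := ih.1 h m (by omega)
        rw [Function.iterate_succ_apply, show m + 1 + k = m + (k + 1) by omega]
        exact this
    · intro h
      have hd : SmoothSeq K N (k + 1) (fun i => u (i + 1) - u i) := ih.2 fun m hm => by
        have := h (m + 1) (by omega)
        rwa [Function.iterate_succ_apply, show m + 1 + k = m + (k + 1) by omega] at this
      refine ⟨fun i hi => ?_, hd⟩
      induction i with
      | zero => simpa using h 0 (by omega)
      | succ i hi' =>
        have := add_mem (hi' (by omega))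
          (Ik_antitone (Nat.le_succ k) (hd.mem_Ik (i := i) (by omega)))
        simpa using this

end SmoothSeq

end SmoothSequences

section LieGen

variable {K} {R : Type*} [Ring R] [Algebra K R]

theorem subset_lieGen (S : Submodule K R) : S ≤ lieGen K S :=
  le_sInf fun _ hT => hT.1

theorem bracket_mem_lieGen {S : Submodule K R} {x y : R} (hx : x ∈ lieGen K S)
    (hy : y ∈ lieGen K S) : x * y - y * x ∈ lieGen K S := by
  simp only [lieGen, Submodule.mem_sInf] at *
  exact fun T hT => hT.2 x (hx T hT) y (hy T hT)

theorem lieGen_le {S T : Submodule K R} (h : S ≤ T)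
    (hT : ∀ x ∈ T, ∀ y ∈ T, x * y - y * x ∈ T) : lieGen K S ≤ T :=
  sInf_le ⟨h, hT⟩

end LieGen

section MatrixEntries

variable {K}

theorem eMat_apply (m : ℕ) (i j : Fin (m + 1)) :
    eMat K m i j = if (j : ℕ) = i + 1 then ((j : ℕ) : K) else 0 := by
  simp only [eMat, Matrix.sum_apply, Matrix.single_apply]
  split_ifs with h
  · rw [Finset.sum_eq_single ⟨i, by omega⟩]
    · rw [if_pos ⟨rfl, by ext; simp [h]⟩]
      simp [h]
    · intro b _ hb
      exact if_neg fun h' => hb (by ext; simp [← h'.1])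
    · simp
  · exact Finset.sum_eq_zero fun x _ => if_neg fun h' => h (by simp [← h'.1, ← h'.2])

theorem fMat_apply (m : ℕ) (i j : Fin (m + 1)) :
    fMat K m i j = if (i : ℕ) = j + 1 then (m : K) - ((j : ℕ) : K) else 0 := by
  simp only [fMat, Matrix.sum_apply, Matrix.single_apply]
  split_ifs with h
  · rw [Finset.sum_eq_single ⟨j, by omega⟩]
    · rw [if_pos ⟨by ext; simp [h], rfl⟩]
      have : (j : ℕ) ≤ m := by omega
      push_cast [this]
      rfl
    · intro b _ hb
      exact if_neg fun h' => hb (by ext; simp [← h'.2])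
    · simp
  · exact Finset.sum_eq_zero fun x _ => if_neg fun h' => h (by simp [← h'.1, ← h'.2])

theorem hMat_apply (m : ℕ) (i j : Fin (m + 1)) :
    hMat K m i j = if i = j then (m : K) - 2 * ((j : ℕ) : K) else 0 := by
  simp only [hMat, Matrix.sum_apply, Matrix.single_apply]
  split_ifs with h
  · subst h
    rw [Finset.sum_eq_single i]
    · simp
    · intro b _ hb
      exact if_neg fun h' => hb h'.1
    · simp
  · exact Finset.sum_eq_zero fun x _ => if_neg fun h' => h (by rw [← h'.1, ← h'.2])

variable {m : ℕ} (X : Matrix (Fin (m + 1)) (Fin (m + 1)) K)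

theorem fMat_mul_succ (i : Fin m) (k : Fin (m + 1)) :
    (fMat K m * X) i.succ k = ((m : K) - ((i : ℕ) : K)) * X i.castSucc k := by
  rw [Matrix.mul_apply, Finset.sum_eq_single i.castSucc]
  · simp [fMat_apply]
  · intro b _ hb
    rw [fMat_apply, if_neg, zero_mul]
    intro h
    exact hb (by ext; simpa using h.symm)
  · simp

theorem fMat_mul_zero (k : Fin (m + 1)) : (fMat K m * X) 0 k = 0 := by
  rw [Matrix.mul_apply]
  exact Finset.sum_eq_zero fun b _ => by simp [fMat_apply]

theorem mul_fMat_castSucc (i : Fin (m + 1)) (k : Fin m) :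
    (X * fMat K m) i k.castSucc = X i k.succ * ((m : K) - ((k : ℕ) : K)) := by
  rw [Matrix.mul_apply, Finset.sum_eq_single k.succ]
  · simp [fMat_apply]
  · intro b _ hb
    rw [fMat_apply, if_neg, mul_zero]
    intro h
    exact hb (by ext; simpa using h)
  · simp

theorem mul_fMat_last (i : Fin (m + 1)) : (X * fMat K m) i (Fin.last m) = 0 := by
  rw [Matrix.mul_apply]
  refine Finset.sum_eq_zero fun b _ => ?_
  rw [fMat_apply, if_neg, mul_zero]
  simp only [Fin.val_last]
  omega

theorem mul_eMat_succ (i : Fin (m + 1)) (k : Fin m) :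
    (X * eMat K m) i k.succ = X i k.castSucc * (((k : ℕ) : K) + 1) := by
  rw [Matrix.mul_apply, Finset.sum_eq_single k.castSucc]
  · simp [eMat_apply]
  · intro b _ hb
    rw [eMat_apply, if_neg, mul_zero]
    intro h
    exact hb (by ext; simpa using h.symm)
  · simp

theorem mul_eMat_zero (i : Fin (m + 1)) : (X * eMat K m) i 0 = 0 := by
  rw [Matrix.mul_apply]
  exact Finset.sum_eq_zero fun b _ => by simp [eMat_apply]

theorem hMat_eq_diagonal (m : ℕ) :
    hMat K m = Matrix.diagonal fun k : Fin (m + 1) => (m : K) - 2 * ((k : ℕ) : K) := by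
  ext i j
  rw [hMat_apply, Matrix.diagonal_apply]
  split_ifs with h
  · rw [h]
  · rfl

/-- The matrix supported on the `s`-th superdiagonal whose entry in column `k` is `q k`. -/
def bandMat (m s : ℕ) (q : ℕ → K) : Matrix (Fin (m + 1)) (Fin (m + 1)) K :=
  Matrix.of fun i k => if (k : ℕ) = i + s then q k else 0

theorem bandMat_apply (s : ℕ) (q : ℕ → K) (i k : Fin (m + 1)) :
    bandMat m s q i k = if (k : ℕ) = i + s then q k else 0 := rfl

theorem bandMat_mul (s t : ℕ) (q r : ℕ → K) :
    bandMat m s q * bandMat m t r = bandMat m (s + t) (fun k => q (k - t) * r k) := by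
  ext i k
  rw [Matrix.mul_apply]
  simp only [bandMat_apply]
  split_ifs with hk
  · rw [Finset.sum_eq_single ⟨k - t, by omega⟩]
    · rw [if_pos (by simp only; omega), if_pos (by simp only; omega)]
    · intro b _ hb
      rw [if_neg (c := (k : ℕ) = b + t), mul_zero]
      exact fun h => hb (by ext; simp only; omega)
    · simp
  · refine Finset.sum_eq_zero fun b _ => ?_
    by_cases h : (k : ℕ) = b + t
    · rw [if_neg (by omega), zero_mul]
    · rw [if_neg h, mul_zero]

theorem fMat_bracket_bandMat (s : ℕ) (q : ℕ → K) (hq : ∀ k ≤ s, q k = 0) :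
    fMat K m * bandMat m (s + 1) q - bandMat m (s + 1) q * fMat K m =
      bandMat m s (fun k => ((m : K) - k + s + 1) * q k - ((m : K) - k) * q (k + 1)) := by
  ext i k
  rw [Matrix.sub_apply]
  have h1 : (fMat K m * bandMat m (s + 1) q) i k =
      if (k : ℕ) = i + s then ((m : K) - (k : ℕ) + s + 1) * q k else 0 := by
    refine Fin.cases ?_ (fun i => ?_) i
    · rw [fMat_mul_zero]
      split_ifs with h
      · rw [hq _ (by simp at h; omega), mul_zero]
      · rfl
    · rw [fMat_mul_succ, bandMat_apply]
      simp only [Fin.val_succ, Fin.val_castSucc]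
      by_cases h : (k : ℕ) = i + (s + 1)
      · rw [if_pos h, if_pos (by omega), h]
        push_cast
        ring
      · rw [if_neg h, if_neg (by omega), mul_zero]
  have h2 : (bandMat m (s + 1) q * fMat K m) i k =
      if (k : ℕ) = i + s then ((m : K) - (k : ℕ)) * q (k + 1) else 0 := by
    refine Fin.lastCases ?_ (fun k => ?_) k
    · rw [mul_fMat_last]
      simp
    · rw [mul_fMat_castSucc, bandMat_apply]
      simp only [Fin.val_succ, Fin.val_castSucc]
      by_cases h : (k : ℕ) = i + s
      · rw [if_pos (by omega), if_pos h, mul_comm]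
      · rw [if_neg (by omega), if_neg h, zero_mul]
  rw [h1, h2, bandMat_apply]
  split_ifs <;> simp

theorem eMat_eq_bandMat (m : ℕ) : eMat K m = bandMat m 1 (fun k => (k : K)) := by
  ext i k
  rw [eMat_apply, bandMat_apply]

variable (K) in
/-- The matrix on the `s`-th superdiagonal with falling factorials of order `D` as entries. -/
def fallMat (m s D : ℕ) : Matrix (Fin (m + 1)) (Fin (m + 1)) K :=
  bandMat m s fun k => ((k.descFactorial D : ℕ) : K)

variable (K) in
/-- The leading part of the bracket of `F₀` with the `(s + 1)`-st power of `E`. -/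
def fallHMat (m s : ℕ) : Matrix (Fin (m + 1)) (Fin (m + 1)) K :=
  bandMat m s fun k => ((k.descFactorial s : ℕ) : K) * (2 * k - s - m)

theorem descFactorial_sub_mul {k s t : ℕ} :
    (((k - t).descFactorial s : ℕ) : K) * ((k.descFactorial t : ℕ) : K) =
      ((k.descFactorial (s + t) : ℕ) : K) := by
  rw [← Nat.cast_mul, ← Nat.descFactorial_mul_descFactorial (Nat.le_add_left t s),
    Nat.add_sub_cancel]

theorem fallMat_mul (s t : ℕ) :
    fallMat K m s s * fallMat K m t t = fallMat K m (s + t) (s + t) := by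
  rw [fallMat, fallMat, bandMat_mul]
  simp only [descFactorial_sub_mul]
  rfl

theorem fallMat_mul_fallHMat (s j : ℕ) :
    fallMat K m s s * fallHMat K m j =
      fallHMat K m (s + j) + (s : K) • fallMat K m (s + j) (s + j) := by
  rw [fallMat, fallHMat, bandMat_mul]
  ext i k
  simp only [fallHMat, fallMat, Matrix.add_apply, Matrix.smul_apply, bandMat_apply]
  split_ifs
  · rw [← mul_assoc, descFactorial_sub_mul]
    push_cast
    simp only [smul_eq_mul]
    ring
  · simp

theorem fallHMat_mul_fallMat (s j : ℕ) :
    fallHMat K m j * fallMat K m s s =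
      fallHMat K m (s + j) - (s : K) • fallMat K m (s + j) (s + j) := by
  rw [fallMat, fallHMat, bandMat_mul, add_comm j s]
  ext i k
  simp only [fallHMat, fallMat, Matrix.sub_apply, Matrix.smul_apply, bandMat_apply]
  split_ifs with h
  · rw [mul_right_comm, descFactorial_sub_mul, add_comm j s]
    have : s ≤ (k : ℕ) := by omega
    push_cast [this]
    simp only [smul_eq_mul]
    ring
  · simp

theorem fMat_bracket_fallMat {s D : ℕ} (h : s ≤ D) :
    fMat K m * fallMat K m (s + 1) (D + 1) - fallMat K m (s + 1) (D + 1) * fMat K m =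
      ((s : K) + D + 2) • fallMat K m s (D + 1) +
        (((D : K) + 1) * (D - m)) • fallMat K m s D := by
  rw [fallMat, fMat_bracket_bandMat]
  · ext i k
    simp only [fallMat, Matrix.add_apply, Matrix.smul_apply, bandMat_apply]
    split_ifs
    · rw [Nat.succ_descFactorial_succ]
      have h1 : (((k : ℕ).descFactorial (D + 1) : ℕ) : K) =
          (((k : ℕ) : K) - D) * (((k : ℕ).descFactorial D : ℕ) : K) := by
        rw [Nat.descFactorial_succ]
        rcases le_or_gt D (k : ℕ) with hk | hk
        · push_cast [hk]
          rfl
        · simp [Nat.descFactorial_eq_zero_iff_lt.2 hk]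
      push_cast
      rw [h1]
      simp only [smul_eq_mul]
      ring
    · simp
  · intro k hk
    rw [Nat.descFactorial_eq_zero_iff_lt.2 (by omega), Nat.cast_zero]

theorem fMat_bracket_fallMat_self (s : ℕ) :
    fMat K m * fallMat K m (s + 1) (s + 1) - fallMat K m (s + 1) (s + 1) * fMat K m =
      ((s : K) + 1) • fallHMat K m s := by
  rw [fMat_bracket_fallMat le_rfl]
  ext i k
  simp only [fallHMat, fallMat, Matrix.add_apply, Matrix.smul_apply, bandMat_apply]
  split_ifs with h
  · rw [Nat.descFactorial_succ]
    have : s ≤ (k : ℕ) := by omega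
    push_cast [this]
    simp only [smul_eq_mul]
    ring
  · simp

theorem fallMat_one_one : fallMat K m 1 1 = eMat K m := by
  rw [eMat_eq_bandMat, fallMat]
  simp

end MatrixEntries

section CurrentAlgebra

variable {K} {Fa : Type*} [Ring Fa] [Algebra K Fa]

/-- The pure tensor `c ⊗ M`, realized as a matrix over `Fa`. -/
def scalarTensor {n : ℕ} (c : Fa) (M : Matrix (Fin n) (Fin n) K) : Matrix (Fin n) (Fin n) Fa :=
  c • M.map (algebraMap K Fa)

section ScalarTensor

variable {n : ℕ}

theorem scalarTensor_apply (c : Fa) (M : Matrix (Fin n) (Fin n) K) (i j : Fin n) :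
    scalarTensor c M i j = M i j • c := by
  simp [scalarTensor, Algebra.smul_def, Algebra.commutes]

theorem scalarTensor_mul (c d : Fa) (M N : Matrix (Fin n) (Fin n) K) :
    scalarTensor c M * scalarTensor d N = scalarTensor (c * d) (M * N) := by
  ext i j
  simp [scalarTensor_apply, Matrix.mul_apply, Finset.sum_smul, smul_smul, mul_comm]

theorem scalarTensor_add (c : Fa) (M N : Matrix (Fin n) (Fin n) K) :
    scalarTensor c (M + N) = scalarTensor c M + scalarTensor c N := by
  ext i j
  simp [scalarTensor_apply, add_smul]

theorem scalarTensor_sub (c : Fa) (M N : Matrix (Fin n) (Fin n) K) :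
    scalarTensor c (M - N) = scalarTensor c M - scalarTensor c N := by
  ext i j
  simp [scalarTensor_apply, sub_smul]

theorem scalarTensor_smul (c : Fa) (a : K) (M : Matrix (Fin n) (Fin n) K) :
    scalarTensor c (a • M) = a • scalarTensor c M := by
  ext i j
  simp [scalarTensor_apply, smul_smul]

theorem scalarTensor_zero (c : Fa) : scalarTensor c (0 : Matrix (Fin n) (Fin n) K) = 0 := by
  ext i j
  simp [scalarTensor_apply]

theorem add_scalarTensor (c d : Fa) (M : Matrix (Fin n) (Fin n) K) :
    scalarTensor (c + d) M = scalarTensor c M + scalarTensor d M := by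
  ext i j
  simp [scalarTensor_apply]

theorem sub_scalarTensor (c d : Fa) (M : Matrix (Fin n) (Fin n) K) :
    scalarTensor (c - d) M = scalarTensor c M - scalarTensor d M := by
  ext i j
  simp [scalarTensor_apply, smul_sub]

theorem smul_scalarTensor (a : K) (c : Fa) (M : Matrix (Fin n) (Fin n) K) :
    scalarTensor (a • c) M = a • scalarTensor c M := by
  ext i j
  simp only [scalarTensor_apply, Matrix.smul_apply]
  exact smul_comm _ _ _

/-- The map `c ↦ c ⊗ M` as a linear map. -/
def tensorRight (M : Matrix (Fin n) (Fin n) K) : Fa →ₗ[K] Matrix (Fin n) (Fin n) Fa where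
  toFun c := scalarTensor c M
  map_add' c d := add_scalarTensor c d M
  map_smul' a c := smul_scalarTensor a c M

end ScalarTensor

variable (K Fa) in
/-- The current Lie algebra of the principal `sl₂` in `M_{m+1}`. -/
abbrev slCurrent (m : ℕ) : Submodule K (Matrix (Fin (m + 1)) (Fin (m + 1)) Fa) :=
  matCurrent K Fa (Submodule.span K {eMat K m, hMat K m, fMat K m})

variable {m : ℕ}

theorem scalarTensor_mem_of_span (c : Fa) {M : Matrix (Fin (m + 1)) (Fin (m + 1)) K}
    (hM : M ∈ Submodule.span K {eMat K m, hMat K m, fMat K m}) :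
    scalarTensor c M ∈ slCurrent K Fa m :=
  subset_lieGen _ (Submodule.subset_span ⟨c, M, hM, rfl⟩)

theorem scalarTensor_eMat_mem (c : Fa) : scalarTensor c (eMat K m) ∈ slCurrent K Fa m :=
  scalarTensor_mem_of_span c (Submodule.subset_span (by simp))

theorem scalarTensor_fMat_mem (c : Fa) : scalarTensor c (fMat K m) ∈ slCurrent K Fa m :=
  scalarTensor_mem_of_span c (Submodule.subset_span (by simp))

theorem slCurrent_bracket_mem {X Y : Matrix (Fin (m + 1)) (Fin (m + 1)) Fa}
    (hX : X ∈ slCurrent K Fa m) (hY : Y ∈ slCurrent K Fa m) :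
    X * Y - Y * X ∈ slCurrent K Fa m :=
  bracket_mem_lieGen hX hY

theorem fMat_bracket_mem {c : Fa} {M : Matrix (Fin (m + 1)) (Fin (m + 1)) K}
    (h : scalarTensor c M ∈ slCurrent K Fa m) :
    scalarTensor c (fMat K m * M - M * fMat K m) ∈ slCurrent K Fa m := by
  have := slCurrent_bracket_mem (scalarTensor_fMat_mem (1 : Fa)) h
  rwa [scalarTensor_mul, scalarTensor_mul, one_mul, mul_one, ← scalarTensor_sub] at this

theorem smul_mem_slCurrent_iff {a : K} (ha : a ≠ 0) {X : Matrix (Fin (m + 1)) (Fin (m + 1)) Fa} :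
    a • X ∈ slCurrent K Fa m ↔ X ∈ slCurrent K Fa m :=
  Submodule.smul_mem_iff _ ha

theorem scalarTensor_fallMat_mem_of_cSp {k : ℕ} {c : Fa}
    (hc : c ∈ cSp K (⊤ : Submodule K Fa) k) :
    scalarTensor c (fallMat K m (k + 1) (k + 1)) ∈ slCurrent K Fa m := by
  induction k generalizing c with
  | zero => simpa [fallMat_one_one] using scalarTensor_eMat_mem c
  | succ k ih =>
    have key : cSp K (⊤ : Submodule K Fa) (k + 1) ≤
        (slCurrent K Fa m).comap (tensorRight (fallMat K m (k + 1 + 1) (k + 1 + 1))) := by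
      refine bSpan_le fun a _ b hb => ?_
      have := slCurrent_bracket_mem (scalarTensor_eMat_mem (m := m) a) (ih hb)
      rw [← fallMat_one_one, scalarTensor_mul, scalarTensor_mul, fallMat_mul, fallMat_mul,
        add_comm 1 (k + 1), ← sub_scalarTensor] at this
      exact this
    exact key hc

variable [CharZero K]

theorem scalarTensor_fallHMat_mem {j : ℕ} {c : Fa}
    (h : scalarTensor c (fallMat K m (j + 1) (j + 1)) ∈ slCurrent K Fa m) :
    scalarTensor c (fallHMat K m j) ∈ slCurrent K Fa m := by
  have := fMat_bracket_mem h
  rwa [fMat_bracket_fallMat_self, scalarTensor_smul,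
    smul_mem_slCurrent_iff (Nat.cast_add_one_ne_zero j)] at this

theorem scalarTensor_fallMat_mem_of_IklS {ℓ k : ℕ} {c : Fa}
    (hc : c ∈ IklS K (⊤ : Submodule K Fa) (ℓ + 1) k) :
    scalarTensor c (fallMat K m (k + 1) (k + 1)) ∈ slCurrent K Fa m := by
  induction ℓ generalizing k c with
  | zero => exact scalarTensor_fallMat_mem_of_cSp hc
  | succ ℓ ih =>
    have key : IklS K (⊤ : Submodule K Fa) (ℓ + 2) k ≤
        (slCurrent K Fa m).comap (tensorRight (fallMat K m (k + 1) (k + 1))) := by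
      refine IklS_succ_succ_le fun i j hij u hu v hv => ?_
      have hb := bracket_mem_IklS hu hv
      have h1 := ih hb
      have h2 := scalarTensor_fallHMat_mem h1
      have h3 := ih (k := i + j) (IklS_succ_le ℓ _ hb)
      have h4 := slCurrent_bracket_mem (scalarTensor_fallMat_mem_of_cSp (m := m) hu)
        (scalarTensor_fallHMat_mem (ih hv))
      rw [scalarTensor_mul, scalarTensor_mul, fallMat_mul_fallHMat, fallHMat_mul_fallMat] at h4
      simp only [show i + 1 + j = i + j + 1 by omega] at h4
      have h5 := add_mem (sub_mem h4 h2) (Submodule.smul_mem _ (((i + 1 : ℕ) : K)) h3)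
      have ne : (2 * ((i + 1 : ℕ) : K)) ≠ 0 := by
        exact_mod_cast (by omega : 2 * (i + 1) ≠ 0)
      change scalarTensor (u * v) (fallMat K m (k + 1) (k + 1)) ∈ slCurrent K Fa m
      rw [← smul_mem_slCurrent_iff ne, ← hij]
      have e : (2 * ((i + 1 : ℕ) : K)) •
          scalarTensor (u * v) (fallMat K m (i + j + 1) (i + j + 1)) =
          scalarTensor (u * v) (fallHMat K m (i + j + 1) +
            ((i + 1 : ℕ) : K) • fallMat K m (i + j + 1) (i + j + 1)) -
          scalarTensor (v * u) (fallHMat K m (i + j + 1) -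
            ((i + 1 : ℕ) : K) • fallMat K m (i + j + 1) (i + j + 1)) -
          scalarTensor (u * v - v * u) (fallHMat K m (i + j + 1)) +
          ((i + 1 : ℕ) : K) •
            scalarTensor (u * v - v * u) (fallMat K m (i + j + 1) (i + j + 1)) := by
        simp only [scalarTensor_add, scalarTensor_sub, sub_scalarTensor, scalarTensor_smul]
        module
      rw [e]
      exact h5
    exact key hc

theorem scalarTensor_fallMat_self_mem {k : ℕ} {c : Fa} (hc : c ∈ Ik K Fa k) :
    scalarTensor c (fallMat K m (k + 1) (k + 1)) ∈ slCurrent K Fa m := by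
  have key : Ik K Fa k ≤
      (slCurrent K Fa m).comap (tensorRight (fallMat K m (k + 1) (k + 1))) :=
    Ik_le fun ℓ c hc => scalarTensor_fallMat_mem_of_IklS hc
  exact key hc

theorem scalarTensor_fallMat_mem {s t : ℕ} {c : Fa} (hc : c ∈ Ik K Fa (s + t)) :
    scalarTensor c (fallMat K m (s + 1) (s + t + 1)) ∈ slCurrent K Fa m := by
  induction t generalizing s with
  | zero => exact scalarTensor_fallMat_self_mem hc
  | succ t ih =>
    have h1 := ih (s := s + 1) (by rwa [add_right_comm])
    have h2 := ih (s := s) (Ik_antitone (by omega) hc)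
    have h3 := fMat_bracket_mem h1
    rw [fMat_bracket_fallMat (by omega), scalarTensor_add, scalarTensor_smul,
      scalarTensor_smul, show s + 1 + t = s + t + 1 by omega] at h3
    have h4 := (Submodule.add_mem_iff_left _ (Submodule.smul_mem _ _ h2)).1 h3
    rwa [smul_mem_slCurrent_iff] at h4
    exact_mod_cast (by omega : s + 1 + (s + t + 1) + 2 ≠ 0)

theorem smoothSeq_band_mem {u : ℕ → Fa} (hu : SmoothSeq K m 0 u) :
    (Matrix.of fun i k : Fin (m + 1) => if (k : ℕ) = i + 1 then ((k : ℕ) : K) • u i else 0) ∈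
      slCurrent K Fa m := by
  have e : (Matrix.of fun i k : Fin (m + 1) => if (k : ℕ) = i + 1 then ((k : ℕ) : K) • u i else 0) =
      ∑ D ∈ Finset.range m, ((D.factorial : ℕ) : K)⁻¹ •
        scalarTensor ((fwdDiff 1)^[D] u 0) (fallMat K m 1 (D + 1)) := by
    ext i k
    simp only [Matrix.of_apply, Matrix.sum_apply, Matrix.smul_apply, scalarTensor_apply, fallMat,
      bandMat_apply]
    split_ifs with h
    · have hN := shift_eq_sum_fwdDiff_iter (1 : ℕ) u i 0
      have hsub : Finset.range ((i : ℕ) + 1) ⊆ Finset.range m := by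
        intro x hx
        simp only [Finset.mem_range] at *
        omega
      rw [Finset.sum_subset hsub fun x _ hx => by
        rw [Nat.choose_eq_zero_of_lt (by simpa using hx), zero_smul]] at hN
      simp only [smul_eq_mul, mul_one, zero_add] at hN
      rw [hN, Finset.smul_sum, h]
      refine Finset.sum_congr rfl fun D _ => ?_
      rw [Nat.succ_descFactorial_succ, Nat.descFactorial_eq_factorial_mul_choose, smul_smul,
        ← Nat.cast_smul_eq_nsmul K, smul_smul]
      congr 1
      have : ((D.factorial : ℕ) : K) ≠ 0 := by exact_mod_cast D.factorial_ne_zero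
      push_cast
      field_simp
    · simp
  rw [e]
  refine sum_mem fun D hD => Submodule.smul_mem _ _ ?_
  have := scalarTensor_fallMat_mem (m := m) (s := 0) (t := D)
    (by simpa using SmoothSeq.iff_fwdDiff.1 hu D (Finset.mem_range.1 hD))
  simpa using this

end CurrentAlgebra

section UpperBound

variable {K} {m : ℕ}

theorem fallHMat_zero (m : ℕ) : fallHMat K m 0 = -hMat K m := by
  ext i k
  simp only [fallHMat, bandMat_apply, Matrix.neg_apply, hMat_apply, Fin.ext_iff, add_zero,
    @eq_comm ℕ k]
  split_ifs <;> simp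

theorem eMat_bracket_fMat (m : ℕ) :
    eMat K m * fMat K m - fMat K m * eMat K m = hMat K m := by
  have h := fMat_bracket_fallMat_self (K := K) (m := m) 0
  rw [fallMat_one_one, fallHMat_zero] at h
  rw [← neg_sub, h]
  simp

theorem hMat_bracket_eMat (m : ℕ) :
    hMat K m * eMat K m - eMat K m * hMat K m = (2 : K) • eMat K m := by
  ext i k
  simp only [hMat_eq_diagonal, Matrix.sub_apply, Matrix.diagonal_mul, Matrix.mul_diagonal,
    eMat_apply, Matrix.smul_apply, smul_eq_mul]
  split_ifs with h
  · rw [h]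
    push_cast
    ring
  · simp

theorem hMat_bracket_fMat (m : ℕ) :
    hMat K m * fMat K m - fMat K m * hMat K m = (-2 : K) • fMat K m := by
  ext i k
  simp only [hMat_eq_diagonal, Matrix.sub_apply, Matrix.diagonal_mul, Matrix.mul_diagonal,
    fMat_apply, Matrix.smul_apply, smul_eq_mul]
  split_ifs with h
  · rw [h]
    push_cast
    ring
  · simp

variable (K) in
/-- The span of the identity and the principal `sl₂` in `M_{m+1}(K)`. -/
def unitalSpan (m : ℕ) : Submodule K (Matrix (Fin (m + 1)) (Fin (m + 1)) K) :=
  Submodule.span K {1, eMat K m, hMat K m, fMat K m}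

theorem unitalSpan_bracket_mem {a b : Matrix (Fin (m + 1)) (Fin (m + 1)) K}
    (ha : a ∈ unitalSpan K m) (hb : b ∈ unitalSpan K m) :
    a * b - b * a ∈ unitalSpan K m := by
  have hE : eMat K m ∈ unitalSpan K m := Submodule.subset_span (by simp)
  have hH : hMat K m ∈ unitalSpan K m := Submodule.subset_span (by simp)
  have hF : fMat K m ∈ unitalSpan K m := Submodule.subset_span (by simp)
  have hEF : eMat K m * fMat K m - fMat K m * eMat K m ∈ unitalSpan K m := by
    rw [eMat_bracket_fMat]
    exact hH
  have hHE : hMat K m * eMat K m - eMat K m * hMat K m ∈ unitalSpan K m := by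
    rw [hMat_bracket_eMat]
    exact Submodule.smul_mem _ _ hE
  have hHF : hMat K m * fMat K m - fMat K m * hMat K m ∈ unitalSpan K m := by
    rw [hMat_bracket_fMat]
    exact Submodule.smul_mem _ _ hF
  have hFE := neg_mem hEF
  have hEH := neg_mem hHE
  have hFH := neg_mem hHF
  rw [neg_sub] at hFE hEH hFH
  refine Submodule.span_induction₂ (p := fun a b _ _ => a * b - b * a ∈ unitalSpan K m)
    ?_ ?_ ?_ ?_ ?_ ?_ ?_ ha hb
  · rintro x y (rfl | rfl | rfl | rfl) (rfl | rfl | rfl | rfl) <;> simp [*]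
  · simp
  · simp
  · intro x y z _ _ _ hx hy
    convert add_mem hx hy using 1
    noncomm_ring
  · intro x y z _ _ _ hx hy
    convert add_mem hx hy using 1
    noncomm_ring
  · intro r x y _ _ h
    convert Submodule.smul_mem _ r h using 1
    simp [smul_sub]
  · intro r x y _ _ h
    convert Submodule.smul_mem _ r h using 1
    simp [smul_sub]

theorem unitalSpan_bracket_pow_mem {a b : Matrix (Fin (m + 1)) (Fin (m + 1)) K} {j : ℕ}
    (ha : a ∈ unitalSpan K m) (hb : b ∈ unitalSpan K m ^ j) :
    a * b - b * a ∈ unitalSpan K m ^ j := by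
  refine Submodule.pow_induction_on_left' _
    (C := fun j b _ => a * b - b * a ∈ unitalSpan K m ^ j) ?_ ?_ ?_ hb
  · intro r
    rw [Algebra.commutes, sub_self]
    exact zero_mem _
  · intro x y i _ _ hx hy
    convert add_mem hx hy using 1
    noncomm_ring
  · intro c hc i x hx h
    have e : a * (c * x) - c * x * a = (a * c - c * a) * x + c * (a * x - x * a) := by
      noncomm_ring
    rw [e, Nat.succ_eq_add_one, pow_succ']
    exact add_mem (Submodule.mul_mem_mul (unitalSpan_bracket_mem ha hc) hx)
      (Submodule.mul_mem_mul hc h)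

theorem unitalSpan_pow_bracket_mem {a b : Matrix (Fin (m + 1)) (Fin (m + 1)) K} {i j : ℕ}
    (ha : a ∈ unitalSpan K m ^ i) (hb : b ∈ unitalSpan K m ^ j) :
    a * b - b * a ∈ unitalSpan K m ^ (i + j - 1) := by
  rcases Nat.eq_zero_or_pos j with rfl | hj
  · rw [pow_zero, Submodule.mem_one] at hb
    obtain ⟨r, rfl⟩ := hb
    rw [Algebra.commutes, sub_self]
    exact zero_mem _
  refine Submodule.pow_induction_on_left' _
    (C := fun i a _ => a * b - b * a ∈ unitalSpan K m ^ (i + j - 1)) ?_ ?_ ?_ ha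
  · intro r
    rw [Algebra.commutes, sub_self]
    exact zero_mem _
  · intro x y i _ _ hx hy
    convert add_mem hx hy using 1
    noncomm_ring
  · intro c hc i x hx h
    have e : c * x * b - b * (c * x) = c * (x * b - b * x) + (c * b - b * c) * x := by
      noncomm_ring
    rw [e]
    refine add_mem ?_ ?_
    · rw [show i.succ + j - 1 = (i + j - 1) + 1 by omega, pow_succ']
      exact Submodule.mul_mem_mul hc h
    · rw [show i.succ + j - 1 = j + i by omega, pow_add]
      exact Submodule.mul_mem_mul (unitalSpan_bracket_pow_mem hc hb) hx

open Polynomial in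
/-- The entries of `a` along each diagonal are the values of a polynomial of degree at most `j`
in the column index, which vanishes at the columns missing from that diagonal. -/
def PolyBands (j : ℕ) (a : Matrix (Fin (m + 1)) (Fin (m + 1)) K) : Prop :=
  ∃ q : ℤ → K[X], (∀ s, (q s).natDegree ≤ j) ∧
    (∀ (k : ℕ) (s : ℤ), (k : ℤ) < s → (q s).eval (k : K) = 0) ∧
    ∀ i k : Fin (m + 1), a i k = (q ((k : ℕ) - (i : ℕ) : ℤ)).eval ((k : ℕ) : K)

namespace PolyBands

open Polynomial

variable {j : ℕ} {a b : Matrix (Fin (m + 1)) (Fin (m + 1)) K}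

theorem zero (j : ℕ) : PolyBands j (0 : Matrix (Fin (m + 1)) (Fin (m + 1)) K) :=
  ⟨fun _ => 0, by simp, by simp, by simp⟩

theorem one : PolyBands 0 (1 : Matrix (Fin (m + 1)) (Fin (m + 1)) K) := by
  refine ⟨fun s => if s = 0 then 1 else 0, fun s => ?_, fun k s h => ?_, fun i k => ?_⟩
  · beta_reduce
    split_ifs <;> simp
  · beta_reduce
    rw [if_neg (by omega)]
    simp
  · rw [Matrix.one_apply]
    by_cases h : i = k
    · simp [h]
    · beta_reduce
      rw [if_neg h, if_neg]
      · simp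
      · intro h'
        exact h (by ext; omega)

theorem add (ha : PolyBands j a) (hb : PolyBands j b) : PolyBands j (a + b) := by
  obtain ⟨q, h1, h2, h3⟩ := ha
  obtain ⟨r, g1, g2, g3⟩ := hb
  refine ⟨fun s => q s + r s, fun s => natDegree_add_le_of_degree_le (h1 s) (g1 s),
    fun k s h => ?_, fun i k => ?_⟩
  · simp [h2 k s h, g2 k s h]
  · simp [h3, g3]

theorem smul (c : K) (ha : PolyBands j a) : PolyBands j (c • a) := by
  obtain ⟨q, h1, h2, h3⟩ := ha
  refine ⟨fun s => c • q s, fun s => (natDegree_smul_le _ _).trans (h1 s),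
    fun k s h => ?_, fun i k => ?_⟩
  · simp [h2 k s h]
  · simp [h3]

theorem mono {l : ℕ} (h : j ≤ l) (ha : PolyBands j a) : PolyBands l a := by
  obtain ⟨q, h1, h2, h3⟩ := ha
  exact ⟨q, fun s => (h1 s).trans h, h2, h3⟩

theorem mul_hMat (ha : PolyBands j a) : PolyBands (j + 1) (a * hMat K m) := by
  obtain ⟨q, h1, h2, h3⟩ := ha
  refine ⟨fun s => q s * (C (m : K) - C 2 * X), fun s => ?_, fun k s h => ?_, fun i k => ?_⟩
  · refine natDegree_mul_le_of_le (h1 s) ?_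
    compute_degree
  · simp [h2 k s h]
  · simp [hMat_eq_diagonal, h3]

theorem mul_eMat (ha : PolyBands j a) : PolyBands (j + 1) (a * eMat K m) := by
  obtain ⟨q, h1, h2, h3⟩ := ha
  refine ⟨fun s => (q (s - 1)).comp (X - C 1) * X, fun s => ?_, fun k s h => ?_, fun i k => ?_⟩
  · refine natDegree_mul_le_of_le ?_ natDegree_X_le
    refine natDegree_comp_le.trans ?_
    rw [natDegree_X_sub_C, mul_one]
    exact h1 _
  · cases k with
    | zero => simp
    | succ k => simp [h2 k (s - 1) (by push_cast at h; omega)]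
  · refine Fin.cases ?_ (fun k => ?_) k
    · simp [mul_eMat_zero]
    · rw [mul_eMat_succ, h3]
      simp [show (((k : ℕ) : ℤ) + 1 - (i : ℕ) - 1) = (k : ℕ) - (i : ℕ) by ring]

theorem mul_fMat (ha : PolyBands j a) : PolyBands (j + 1) (a * fMat K m) := by
  obtain ⟨q, h1, h2, h3⟩ := ha
  refine ⟨fun s => (q (s + 1)).comp (X + C 1) * (C (m : K) - X), fun s => ?_, fun k s h => ?_,
    fun i k => ?_⟩
  · refine natDegree_mul_le_of_le ?_ ?_
    · refine natDegree_comp_le.trans ?_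
      rw [natDegree_X_add_C, mul_one]
      exact h1 _
    · compute_degree
  · have := h2 (k + 1) (s + 1) (by push_cast; omega)
    push_cast at this
    simp [this]
  · refine Fin.lastCases ?_ (fun k => ?_) k
    · simp [mul_fMat_last]
    · rw [mul_fMat_castSucc, h3]
      simp [show (((k : ℕ) : ℤ) + 1 - (i : ℕ)) = (k : ℕ) - (i : ℕ) + 1 by ring]

theorem of_mem_pow (ha : a ∈ unitalSpan K m ^ j) : PolyBands j a := by
  induction j generalizing a with
  | zero =>
    rw [pow_zero, Submodule.mem_one] at ha
    obtain ⟨r, rfl⟩ := ha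
    rw [Algebra.algebraMap_eq_smul_one]
    exact one.smul r
  | succ j ih =>
    rw [pow_succ] at ha
    refine Submodule.mul_induction_on ha (fun x hx y hy => ?_) fun _ _ => add
    have hx := ih hx
    refine Submodule.span_induction (p := fun y _ => PolyBands (j + 1) (x * y))
      ?_ ?_ ?_ ?_ hy
    · rintro y (rfl | rfl | rfl | rfl)
      · rw [mul_one]
        exact hx.mono (Nat.le_succ j)
      · exact hx.mul_eMat
      · exact hx.mul_hMat
      · exact hx.mul_fMat
    · rw [mul_zero]
      exact zero _
    · intro y z _ _ hy hz
      rw [mul_add]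
      exact hy.add hz
    · intro c y _ hy
      rw [mul_smul_comm]
      exact hy.smul c

theorem exists_superdiagonal (ha : PolyBands j a) :
    ∃ p : K[X], (p = 0 ∨ p.natDegree + 1 ≤ j) ∧
      ∀ i k : Fin (m + 1), (k : ℕ) = i + 1 → a i k = ((i : ℕ) + 1 : K) * p.eval ((i : ℕ) : K) := by
  obtain ⟨q, h1, h2, h3⟩ := ha
  have h0 : (q 1).coeff 0 = 0 := by simpa [coeff_zero_eq_eval_zero] using h2 0 1 (by simp)
  have hX : (q 1).divX * X = q 1 := by simpa [h0] using divX_mul_X_add (q 1)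
  refine ⟨(q 1).divX.comp (X + C 1), ?_, fun i k hik => ?_⟩
  · by_cases hq : (q 1).divX = 0
    · simp [hq]
    · right
      rw [natDegree_comp, natDegree_X_add_C, mul_one]
      have := h1 1
      rwa [← hX, natDegree_mul_X hq] at this
  · rw [h3, show ((k : ℕ) : ℤ) - (i : ℕ) = 1 by omega, hik]
    conv_lhs => rw [← hX]
    simp [mul_comm]

end PolyBands

variable {R : Type*} [Ring R] [Algebra K R]

theorem fwdDiff_iter_eval_smul (p : Polynomial K) (c : R) (n : ℕ) :
    (fwdDiff 1)^[n] (fun i : ℕ => p.eval (i : K) • c) 0 = ((fwdDiff 1)^[n] p.eval 0) • c := by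
  simp only [fwdDiff_iter_eq_sum_shift, Finset.sum_smul]
  refine Finset.sum_congr rfl fun k _ => ?_
  rw [smul_assoc]
  simp only [zero_add, smul_eq_mul, nsmul_eq_mul, mul_one]

theorem smoothSeq_eval_smul (N : ℕ) {p : Polynomial K} {c : R} {d : ℕ}
    (hp : p = 0 ∨ p.natDegree ≤ d) (hc : c ∈ Ik K R d) :
    SmoothSeq K N 0 (fun i : ℕ => p.eval (i : K) • c) := by
  rcases hp with rfl | hp
  · simpa using SmoothSeq.zero N 0
  refine SmoothSeq.iff_fwdDiff.2 fun n _ => ?_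
  rw [fwdDiff_iter_eval_smul]
  rcases le_or_gt n d with h | h
  · exact Submodule.smul_mem _ _ (Ik_antitone (by simpa using h) hc)
  · rw [Polynomial.fwdDiff_iter_eq_zero_of_degree_lt (hp.trans_lt h)]
    simp

variable (K R) in
/-- The filtered upper bound for the current Lie algebra. -/
def filteredSpan (m : ℕ) : Submodule K (Matrix (Fin (m + 1)) (Fin (m + 1)) R) :=
  Submodule.span K {X | ∃ j : ℕ, ∃ c ∈ Ik K R (j - 1), ∃ a ∈ unitalSpan K m ^ j,
    X = scalarTensor c a}

theorem scalarTensor_mem_filteredSpan {j k : ℕ} {c : R}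
    {a : Matrix (Fin (m + 1)) (Fin (m + 1)) K} (hjk : j ≤ k + 1)
    (hc : c ∈ Ik K R k) (ha : a ∈ unitalSpan K m ^ j) :
    scalarTensor c a ∈ filteredSpan K R m :=
  Submodule.subset_span ⟨j, c, Ik_antitone (by omega) hc, a, ha, rfl⟩

theorem filteredSpan_bracket_mem {X Y : Matrix (Fin (m + 1)) (Fin (m + 1)) R}
    (hX : X ∈ filteredSpan K R m) (hY : Y ∈ filteredSpan K R m) :
    X * Y - Y * X ∈ filteredSpan K R m := by
  refine Submodule.span_induction₂ (p := fun X Y _ _ => X * Y - Y * X ∈ filteredSpan K R m)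
    ?_ ?_ ?_ ?_ ?_ ?_ ?_ hX hY
  · rintro _ _ ⟨i, c, hc, a, ha, rfl⟩ ⟨j, d, hd, b, hb, rfl⟩
    have e : scalarTensor c a * scalarTensor d b - scalarTensor d b * scalarTensor c a =
        scalarTensor (c * d - d * c) (a * b) + scalarTensor (d * c) (a * b - b * a) := by
      rw [scalarTensor_mul, scalarTensor_mul, sub_scalarTensor, scalarTensor_sub]
      abel
    rw [e]
    refine add_mem ?_ ?_
    · exact scalarTensor_mem_filteredSpan (j := i + j) (by omega) (bracket_mem_Ik hc hd)
        (by rw [pow_add]; exact Submodule.mul_mem_mul ha hb)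
    · exact scalarTensor_mem_filteredSpan (by omega) (mul_mem_Ik hd hc)
        (unitalSpan_pow_bracket_mem ha hb)
  · simp
  · simp
  · intro x y z _ _ _ hx hy
    convert add_mem hx hy using 1
    noncomm_ring
  · intro x y z _ _ _ hx hy
    convert add_mem hx hy using 1
    noncomm_ring
  · intro r x y _ _ h
    convert Submodule.smul_mem _ r h using 1
    simp [smul_sub]
  · intro r x y _ _ h
    convert Submodule.smul_mem _ r h using 1
    simp [smul_sub]

theorem slCurrent_le_filteredSpan : slCurrent K R m ≤ filteredSpan K R m := by
  refine lieGen_le (Submodule.span_le.2 ?_) fun x hx y hy => filteredSpan_bracket_mem hx hy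
  rintro _ ⟨u, M, hM, rfl⟩
  refine scalarTensor_mem_filteredSpan (j := 1) le_rfl (mem_Ik_zero u) ?_
  rw [pow_one]
  exact Submodule.span_mono (by simp) hM

theorem smoothSeq_of_mem_slCurrent [CharZero K] {X : Matrix (Fin (m + 1)) (Fin (m + 1)) R}
    (hX : X ∈ slCurrent K R m) {u : ℕ → R}
    (hu : ∀ i k : Fin (m + 1), (k : ℕ) = i + 1 → X i k = ((i : ℕ) + 1 : K) • u i) :
    SmoothSeq K m 0 u := by
  have key : ∃ v : ℕ → R, SmoothSeq K m 0 v ∧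
      ∀ i k : Fin (m + 1), (k : ℕ) = i + 1 → X i k = ((i : ℕ) + 1 : K) • v i := by
    refine Submodule.span_induction (p := fun X _ => ∃ v : ℕ → R, SmoothSeq K m 0 v ∧
      ∀ i k : Fin (m + 1), (k : ℕ) = i + 1 → X i k = ((i : ℕ) + 1 : K) • v i)
      ?_ ?_ ?_ ?_ (slCurrent_le_filteredSpan hX)
    · rintro _ ⟨j, c, hc, a, ha, rfl⟩
      obtain ⟨p, hp, h⟩ := (PolyBands.of_mem_pow ha).exists_superdiagonal
      refine ⟨fun i => p.eval (i : K) • c,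
        smoothSeq_eval_smul m (hp.imp_right fun h => by omega) hc, fun i k hik => ?_⟩
      rw [scalarTensor_apply, h i k hik, mul_smul]
    · exact ⟨fun _ => 0, SmoothSeq.zero m 0, by simp⟩
    · rintro x y _ _ ⟨v, hv, hv'⟩ ⟨w, hw, hw'⟩
      refine ⟨fun i => v i + w i, hv.add hw, fun i k hik => ?_⟩
      rw [Matrix.add_apply, hv' i k hik, hw' i k hik, smul_add]
    · rintro c x _ ⟨v, hv, hv'⟩
      refine ⟨fun i => algebraMap K R c * v i,
        (SmoothSeq.const m (mem_Ik_zero (algebraMap K R c))).zero_mul hv, fun i k hik => ?_⟩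
      rw [Matrix.smul_apply, hv' i k hik, smul_comm, Algebra.smul_def c]
  obtain ⟨v, hv, hv'⟩ := key
  refine hv.congr fun i hi => ?_
  have h1 := hv' ⟨i, by omega⟩ ⟨i + 1, by omega⟩ rfl
  rw [hu _ _ rfl] at h1
  exact (smul_right_injective R (Nat.cast_add_one_ne_zero (R := K) i) h1).symm

end UpperBound

section DiagonalConjugation

variable {K} {m : ℕ} {Fa : Type*} [Ring Fa] [Algebra K Fa]

theorem submatrix_rev_mul {R : Type*} [Ring R] {n : ℕ} (M N : Matrix (Fin n) (Fin n) R) :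
    (M * N).submatrix Fin.rev Fin.rev =
      M.submatrix Fin.rev Fin.rev * N.submatrix Fin.rev Fin.rev :=
  (Matrix.submatrix_mul_equiv M N Fin.rev Fin.revPerm Fin.rev).symm

theorem eMat_submatrix_rev (m : ℕ) : (eMat K m).submatrix Fin.rev Fin.rev = fMat K m := by
  ext i k
  simp only [Matrix.submatrix_apply, eMat_apply, fMat_apply, Fin.val_rev]
  have hi := i.isLt
  have hk := k.isLt
  by_cases h : (i : ℕ) = k + 1
  · rw [if_pos (by omega), if_pos h]
    rw [← Nat.cast_sub (by omega), show m + 1 - (k + 1) = m - (k : ℕ) by omega]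
  · rw [if_neg (by omega), if_neg h]

theorem fMat_submatrix_rev (m : ℕ) : (fMat K m).submatrix Fin.rev Fin.rev = eMat K m := by
  rw [← eMat_submatrix_rev, Matrix.submatrix_submatrix]
  simp [Function.Involutive.comp_self Fin.rev_involutive]

theorem hMat_submatrix_rev (m : ℕ) : (hMat K m).submatrix Fin.rev Fin.rev = -hMat K m := by
  rw [← eMat_bracket_fMat, Matrix.submatrix_sub]
  simp only [Pi.sub_apply]
  rw [submatrix_rev_mul, submatrix_rev_mul, eMat_submatrix_rev, fMat_submatrix_rev, neg_sub]

theorem submatrix_rev_mem_slCurrent {X : Matrix (Fin (m + 1)) (Fin (m + 1)) Fa}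
    (hX : X ∈ slCurrent K Fa m) : X.submatrix Fin.rev Fin.rev ∈ slCurrent K Fa m := by
  have key : slCurrent K Fa m ≤ (slCurrent K Fa m).comap
      (Matrix.reindexLinearEquiv K Fa Fin.revPerm Fin.revPerm).toLinearMap := by
    refine lieGen_le (Submodule.span_le.2 ?_) fun x hx y hy => ?_
    · rintro _ ⟨u, M, hM, rfl⟩
      have hM' : M.submatrix Fin.rev Fin.rev ∈
          Submodule.span K {eMat K m, hMat K m, fMat K m} := by
        refine Submodule.span_induction (p := fun M _ => M.submatrix Fin.rev Fin.rev ∈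
          Submodule.span K {eMat K m, hMat K m, fMat K m}) ?_ ?_ ?_ ?_ hM
        · rintro M (rfl | rfl | rfl)
          · rw [eMat_submatrix_rev]
            exact Submodule.subset_span (by simp)
          · rw [hMat_submatrix_rev]
            exact neg_mem (Submodule.subset_span (by simp))
          · rw [fMat_submatrix_rev]
            exact Submodule.subset_span (by simp)
        · exact zero_mem _
        · intro x y _ _ hx hy
          exact add_mem hx hy
        · intro c x _ hx
          exact Submodule.smul_mem _ c hx
      exact scalarTensor_mem_of_span u hM'
    · have := slCurrent_bracket_mem hx hy
      change (x * y - y * x).submatrix Fin.rev Fin.rev ∈ slCurrent K Fa m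
      rw [Matrix.submatrix_sub]
      simp only [Pi.sub_apply, submatrix_rev_mul]
      exact this
  exact key hX

/-- Conjugation of an `(m + 1)`-square matrix by the diagonal matrix of the units `f 0, …, f m`. -/
def diagConj (m : ℕ) (f : ℕ → Faˣ) (X : Matrix (Fin (m + 1)) (Fin (m + 1)) Fa) :
    Matrix (Fin (m + 1)) (Fin (m + 1)) Fa :=
  Matrix.diagonal (fun i : Fin (m + 1) => (f i : Fa)) * X *
    Matrix.diagonal (fun i : Fin (m + 1) => ((f i)⁻¹ : Faˣ).1)

theorem diagConj_apply (f : ℕ → Faˣ) (X : Matrix (Fin (m + 1)) (Fin (m + 1)) Fa)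
    (i k : Fin (m + 1)) : diagConj m f X i k = f i * X i k * ((f k)⁻¹ : Faˣ).1 := by
  simp [diagConj]

theorem diagConj_mul (f : ℕ → Faˣ) (X Y : Matrix (Fin (m + 1)) (Fin (m + 1)) Fa) :
    diagConj m f (X * Y) = diagConj m f X * diagConj m f Y := by
  have h : Matrix.diagonal (fun i : Fin (m + 1) => ((f i)⁻¹ : Faˣ).1) *
      Matrix.diagonal (fun i : Fin (m + 1) => (f i : Fa)) = 1 := by
    simp
  have e : X * Y = X * (Matrix.diagonal (fun i : Fin (m + 1) => ((f i)⁻¹ : Faˣ).1) *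
      Matrix.diagonal (fun i : Fin (m + 1) => (f i : Fa))) * Y := by
    rw [h, mul_one]
  rw [e]
  simp only [diagConj, mul_assoc]

theorem diagConj_inv_diagConj (f : ℕ → Faˣ) (X : Matrix (Fin (m + 1)) (Fin (m + 1)) Fa) :
    diagConj m f (diagConj m (fun i => (f i)⁻¹) X) = X := by
  ext i k
  simp [diagConj_apply, mul_assoc]

theorem diagConj_submatrix_rev (f : ℕ → Faˣ) (X : Matrix (Fin (m + 1)) (Fin (m + 1)) Fa) :
    (diagConj m (fun i => f (m - i)) X).submatrix Fin.rev Fin.rev =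
      diagConj m f (X.submatrix Fin.rev Fin.rev) := by
  ext i k
  have hi := i.isLt
  have hk := k.isLt
  simp only [Matrix.submatrix_apply, diagConj_apply, Fin.val_rev]
  rw [show m - (m + 1 - (i + 1)) = (i : ℕ) by omega, show m - (m + 1 - (k + 1)) = (k : ℕ) by omega]

variable (K) in
/-- `diagConj` as a linear map. -/
def diagConjₗ (m : ℕ) (f : ℕ → Faˣ) :
    Matrix (Fin (m + 1)) (Fin (m + 1)) Fa →ₗ[K] Matrix (Fin (m + 1)) (Fin (m + 1)) Fa where
  toFun := diagConj m f
  map_add' X Y := by simp [diagConj, mul_add, add_mul]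
  map_smul' c X := by simp [diagConj]

theorem diagConj_eMat_apply (f : ℕ → Faˣ) (x : Fa) (i k : Fin (m + 1)) :
    diagConj m f (scalarTensor x (eMat K m)) i k =
      if (k : ℕ) = i + 1 then ((k : ℕ) : K) • (f i * x * ((f (i + 1))⁻¹ : Faˣ).1) else 0 := by
  rw [diagConj_apply, scalarTensor_apply, eMat_apply]
  split_ifs with h
  · simp [h]
  · simp

theorem alternating_sum_mem_Ik_iff (u : ℕ → Fa) (n l : ℕ) :
    (∑ r : Fin (n + 1), ((-1 : ℤ) ^ (r : ℕ) * (n.choose (r : ℕ) : ℤ)) • u r) ∈ Ik K Fa l ↔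
      (fwdDiff 1)^[n] u 0 ∈ Ik K Fa l := by
  have e : (fwdDiff 1)^[n] u 0 = (-1 : ℤ) ^ n •
      ∑ r : Fin (n + 1), ((-1 : ℤ) ^ (r : ℕ) * (n.choose (r : ℕ) : ℤ)) • u r := by
    rw [fwdDiff_iter_eq_sum_shift, Fin.sum_univ_eq_sum_range
      (fun r => ((-1 : ℤ) ^ r * (n.choose r : ℤ)) • u r), Finset.smul_sum]
    refine Finset.sum_congr rfl fun r hr => ?_
    obtain ⟨s, rfl⟩ := Nat.exists_eq_add_of_le (Nat.lt_succ_iff.1 (Finset.mem_range.1 hr))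
    rw [smul_smul, ← mul_assoc, ← pow_add, add_tsub_cancel_left,
      show r + s + r = s + 2 * r by ring, pow_add, pow_mul]
    simp
  rw [e]
  rcases neg_one_pow_eq_or ℤ n with h | h <;> simp [h]

variable [CharZero K] {f : ℕ → Faˣ}

theorem diagConj_eMat_mem (hf : SmoothSeq K m 0 (fun i => (f i : Fa) * ((f (i + 1))⁻¹ : Faˣ).1))
    (x : Fa) : diagConj m f (scalarTensor x (eMat K m)) ∈ slCurrent K Fa m := by
  convert smoothSeq_band_mem (SmoothSeq.mul_mul_inv_succ hf x) using 1
  ext i k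
  rw [diagConj_eMat_apply, Matrix.of_apply]

theorem diagConj_fMat_mem (hf : SmoothSeq K m 0 (fun i => (f i : Fa) * ((f (i + 1))⁻¹ : Faˣ).1))
    (x : Fa) : diagConj m f (scalarTensor x (fMat K m)) ∈ slCurrent K Fa m := by
  have h := submatrix_rev_mem_slCurrent
    (diagConj_eMat_mem (f := fun i => f (m - i)) (SmoothSeq.reverse_units hf) x)
  rw [diagConj_submatrix_rev] at h
  convert h using 2
  rw [← eMat_submatrix_rev]
  rfl

theorem diagConj_mem (hf : SmoothSeq K m 0 (fun i => (f i : Fa) * ((f (i + 1))⁻¹ : Faˣ).1))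
    {X : Matrix (Fin (m + 1)) (Fin (m + 1)) Fa} (hX : X ∈ slCurrent K Fa m) :
    diagConj m f X ∈ slCurrent K Fa m := by
  have hbr {X Y : Matrix (Fin (m + 1)) (Fin (m + 1)) Fa}
      (hX : X ∈ (slCurrent K Fa m).comap (diagConjₗ K m f))
      (hY : Y ∈ (slCurrent K Fa m).comap (diagConjₗ K m f)) :
      X * Y - Y * X ∈ (slCurrent K Fa m).comap (diagConjₗ K m f) := by
    rw [Submodule.mem_comap, map_sub]
    change diagConj m f (X * Y) - diagConj m f (Y * X) ∈ _
    rw [diagConj_mul, diagConj_mul]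
    exact slCurrent_bracket_mem hX hY
  have key : slCurrent K Fa m ≤ (slCurrent K Fa m).comap (diagConjₗ K m f) := by
    refine lieGen_le (Submodule.span_le.2 ?_) fun x hx y hy => hbr hx hy
    rintro _ ⟨u, M, hM, rfl⟩
    change scalarTensor u M ∈ (slCurrent K Fa m).comap (diagConjₗ K m f)
    refine Submodule.span_induction (p := fun M _ => scalarTensor u M ∈
      (slCurrent K Fa m).comap (diagConjₗ K m f)) ?_ ?_ ?_ ?_ hM
    · rintro M (rfl | rfl | rfl)
      · exact diagConj_eMat_mem hf u
      · have := hbr (X := scalarTensor u (eMat K m)) (Y := scalarTensor 1 (fMat K m))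
          (diagConj_eMat_mem hf u) (diagConj_fMat_mem hf 1)
        rwa [scalarTensor_mul, scalarTensor_mul, one_mul, mul_one, ← scalarTensor_sub,
          eMat_bracket_fMat] at this
      · exact diagConj_fMat_mem hf u
    · rw [scalarTensor_zero]
      exact zero_mem _
    · intro x y _ _ hx hy
      rw [scalarTensor_add]
      exact add_mem hx hy
    · intro c x _ hx
      rw [scalarTensor_smul]
      exact Submodule.smul_mem _ c hx
  exact key hX

theorem diagConj_image_slCurrent_iff :
    {X | ∃ Y ∈ slCurrent K Fa m, X = diagConj m f Y} =
        (slCurrent K Fa m : Set (Matrix (Fin (m + 1)) (Fin (m + 1)) Fa)) ↔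
      SmoothSeq K m 0 (fun i => (f i : Fa) * ((f (i + 1))⁻¹ : Faˣ).1) := by
  refine ⟨fun h => ?_, fun hf => ?_⟩
  · refine smoothSeq_of_mem_slCurrent (X := diagConj m f (scalarTensor 1 (eMat K m))) ?_ ?_
    · exact h.subset ⟨_, scalarTensor_eMat_mem 1, rfl⟩
    · intro i k hik
      rw [diagConj_eMat_apply, if_pos hik, hik, mul_one]
      push_cast
      rfl
  · refine Set.Subset.antisymm ?_ fun X hX => ?_
    · rintro _ ⟨Y, hY, rfl⟩
      exact diagConj_mem hf hY
    · refine ⟨diagConj m (fun i => (f i)⁻¹) X, diagConj_mem ?_ hX,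
        (diagConj_inv_diagConj f X).symm⟩
      simpa using SmoothSeq.inv_mul_succ hf

end DiagonalConjugation

/-- for `g = span{E,H,F₀} ⊆ A = M_n(k)` (the irreducible `n`-dimensional
representation of `sl₂(k)`, `n = mm+1 ≥ 2`), an invertible diagonal matrix
`D = diag(f₁,…,f_n)` normalizes `(g,A)(F)` iff the difference derivatives
`Δ^(m)(f₁f₂⁻¹, …, f_{m+1}f_{m+2}⁻¹)` lie in `I_m(F)` for `m = 1, …, n−2`. -/
theorem statement19 {K : Type*} [Field K] [CharZero K]
    {Fa : Type*} [Ring Fa] [Algebra K Fa]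
    (mm : ℕ) (hmm : 1 ≤ mm)
    (d : Fin (mm + 1) → Faˣ) :
    {X : Matrix (Fin (mm + 1)) (Fin (mm + 1)) Fa |
        ∃ Y ∈ matCurrent K Fa (Submodule.span K {eMat K mm, hMat K mm, fMat K mm}),
          X = Matrix.diagonal (fun i => (d i : Fa)) * Y *
              Matrix.diagonal (fun i => (((d i)⁻¹ : Faˣ) : Fa))} =
      (matCurrent K Fa (Submodule.span K {eMat K mm, hMat K mm, fMat K mm}) :
        Set (Matrix (Fin (mm + 1)) (Fin (mm + 1)) Fa)) ↔
    ∀ (m : ℕ) (hm1 : 1 ≤ m) (hm2 : m ≤ mm - 1),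
      (∑ r : Fin (m + 1), ((-1 : ℤ) ^ (r : ℕ) * (m.choose (r : ℕ) : ℤ)) •
        ((d (⟨(r : ℕ), by have hr := r.isLt; omega⟩ : Fin (mm + 1)) : Fa) *
          (((d (⟨(r : ℕ) + 1, by have hr := r.isLt; omega⟩ : Fin (mm + 1)))⁻¹ : Faˣ) : Fa))) ∈
      Ik K Fa m := by
  set f : ℕ → Faˣ := fun i => if h : i < mm + 1 then d ⟨i, h⟩ else 1 with hf
  have hfd (i : Fin (mm + 1)) : d i = f i := by simp only [hf, i.isLt, dif_pos]
  simp only [hfd]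
  refine diagConj_image_slCurrent_iff.trans (SmoothSeq.iff_fwdDiff.trans
    ⟨fun h n _ hn => ?_, fun h n hn => ?_⟩)
  · exact (alternating_sum_mem_Ik_iff
      (fun i => (f i : Fa) * ((f (i + 1))⁻¹ : Faˣ).1) n n).2 (h n (by omega))
  · rcases Nat.eq_zero_or_pos n with rfl | hn0
    · exact mem_Ik_zero _
    · exact (alternating_sum_mem_Ik_iff
        (fun i => (f i : Fa) * ((f (i + 1))⁻¹ : Faˣ).1) n n).1 (h n hn0 (by omega))
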